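/- arXiv:2012.07643 — 6 statements merged into one kernel-verified Lean document; each statement's English description precedes it below -/
import Mathlib

section
/- Let Φ be a complex-linear map from the bounded operators on H to the bounded operators on H such that Φ(X ∘ B) = Φ(X) ∘ B for every finite-rank operator X and every finite-rank operator B, and suppose there is a constant C ≥ 0 with ‖Φ(X)‖ ≤ C‖X‖ (operator norms) for every finite-rank X. Then there exists a bounded linear operator H̃ : H → H such that Φ(X) = H̃ ∘ X for every finite-rank operator X. (This is the key step showing that any bounded operator on the Hilbert–Schmidt space commuting with all right multiplications is a left multiplication, i.e., (𝔄_r)′ = 𝔄_l.) -/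
/-- A continuous linear operator is finite-rank if its range is finite-dimensional. -/
def IsFiniteRankOp {H : Type*} [NormedAddCommGroup H] [InnerProductSpace ℂ H]
    (X : H →L[ℂ] H) : Prop :=
  FiniteDimensional ℂ (LinearMap.range (X : H →ₗ[ℂ] H))

theorem isFiniteRankOp_rankOne {H : Type*} [NormedAddCommGroup H] [InnerProductSpace ℂ H]
    (x y : H) : IsFiniteRankOp (InnerProductSpace.rankOne ℂ x y) := by
  have h : LinearMap.range (InnerProductSpace.rankOne ℂ x y : H →ₗ[ℂ] H) ≤
      Submodule.span ℂ {x} := by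
    rintro _ ⟨z, rfl⟩
    exact Submodule.smul_mem _ _ (Submodule.mem_span_singleton_self x)
  exact Submodule.finiteDimensional_of_le h

/-- Let `Φ` be a complex-linear map on bounded operators of a separable infinite-dimensional
complex Hilbert space such that `Φ (X ∘ B) = Φ X ∘ B` for all finite-rank `X, B`, and which
is bounded on finite-rank operators: `‖Φ X‖ ≤ C ‖X‖`.  Then there is a bounded operator `H̃`
with `Φ X = H̃ ∘ X` for every finite-rank `X`.  (Key step for `(𝔄_r)′ = 𝔄_l`.) -/
theorem stmt7 {H : Type*} [NormedAddCommGroup H] [InnerProductSpace ℂ H] [CompleteSpace H]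
    (e : HilbertBasis ℕ ℂ H)
    (Φ : (H →L[ℂ] H) →ₗ[ℂ] (H →L[ℂ] H))
    (hmul : ∀ X B : H →L[ℂ] H, IsFiniteRankOp X → IsFiniteRankOp B →
      Φ (X ∘L B) = Φ X ∘L B)
    (C : ℝ) (hC : 0 ≤ C)
    (hbdd : ∀ X : H →L[ℂ] H, IsFiniteRankOp X → ‖Φ X‖ ≤ C * ‖X‖) :
    ∃ Htilde : H →L[ℂ] H, ∀ X : H →L[ℂ] H, IsFiniteRankOp X → Φ X = Htilde ∘L X := by
  have hu : ‖e 0‖ = 1 := e.orthonormal.1 0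
  let T : H →ₗ[ℂ] H :=
    { toFun := fun v => Φ (InnerProductSpace.rankOne ℂ v (e 0)) (e 0)
      map_add' := fun v w => by simp
      map_smul' := fun c v => by simp }
  refine ⟨T.mkContinuous C fun v => ?_, fun X hX => ?_⟩
  · have h := (Φ (InnerProductSpace.rankOne ℂ v (e 0))).le_opNorm (e 0)
    have h' := hbdd _ (isFiniteRankOp_rankOne v (e 0))
    rw [hu, mul_one] at h
    rw [InnerProductSpace.norm_rankOne, hu, mul_one] at h'
    exact h.trans h'
  · ext z
    have h := congrArg (fun A : H →L[ℂ] H => A (e 0))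
      (hmul X _ hX (isFiniteRankOp_rankOne z (e 0)))
    simp only [InnerProductSpace.comp_rankOne, InnerProductSpace.rankOne_apply,
      inner_self_eq_norm_sq_to_K, hu] at h
    simpa [T] using h.symm
end

section
/- Let n be a finite nonempty index type, let p, q > 1 be real numbers with 1/p + 1/q = 1, and let A be an n×n complex matrix. Then (Tr(|A|^p))^{1/p} = sup { |Tr(A·B)| : B an n×n complex matrix with Tr(|B|^q) ≤ 1 }, where |M| denotes the positive semidefinite square root of MᴴM, |M|^r its r-th power via the functional calculus (equivalently, Tr(|M|^r) is the sum of the r-th powers of the singular values of M), and Tr is the matrix trace. -/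
open scoped ComplexOrder

/-- `Tr(|A|^r)` for a complex square matrix `A`: the sum of the `r`-th powers of the
singular values of `A`, i.e. of the square roots of the eigenvalues of `Aᴴ A`.  This equals
the trace of the `r`-th power (functional calculus) of the positive semidefinite square
root `|A|` of `Aᴴ A`. -/
noncomputable def traceAbsRpow {n : Type*} [Fintype n] [DecidableEq n]
    (A : Matrix n n ℂ) (r : ℝ) : ℝ :=
  ∑ i, Real.sqrt ((Matrix.posSemidef_conjTranspose_mul_self A).1.eigenvalues i) ^ r

open Matrix in
/-- A matrix `F` whose Gram matrix is diagonal, with entries `d i ^ 2`, factors as a unitary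
matrix times `diagonal d`. -/
theorem exists_unitary_mul_diagonal_of_gram {n : Type*} [Fintype n] [DecidableEq n]
    (F : Matrix n n ℂ) (d : n → ℝ) (h : Fᴴ * F = diagonal fun i => ((d i ^ 2 : ℝ) : ℂ)) :
    ∃ U ∈ unitaryGroup n ℂ, F = U * diagonal fun i => (d i : ℂ) := by
  let f : n → EuclideanSpace ℂ n := fun j => WithLp.toLp 2 fun i => F i j
  have hf (i j : n) : inner ℂ (f i) (f j) = if i = j then ((d i ^ 2 : ℝ) : ℂ) else 0 := by
    trans (Fᴴ * F) i j
    · simp [f, PiLp.inner_apply, mul_apply, mul_comm]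
    · rw [h, diagonal_apply]
  let g : n → EuclideanSpace ℂ n := fun j => ((d j)⁻¹ : ℂ) • f j
  have hg : Orthonormal ℂ (({i | d i ≠ 0} : Set n).domRestrict g) := by
    rw [orthonormal_iff_ite]
    rintro ⟨i, hi⟩ ⟨j, hj⟩
    have hi' : (d i : ℂ) ≠ 0 := by exact_mod_cast hi
    by_cases hij : i = j
    · subst hij
      simp only [Set.domRestrict_apply, g, inner_smul_left, inner_smul_right, hf, if_true,
        map_inv₀, Complex.conj_ofReal, Complex.ofReal_pow]
      field_simp
    · simp [g, inner_smul_left, inner_smul_right, hf, hij]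
  obtain ⟨b, hb⟩ := hg.exists_orthonormalBasis_extension_of_card_eq (by simp)
  refine ⟨(EuclideanSpace.basisFun n ℂ).toBasis.toMatrix b,
    (EuclideanSpace.basisFun n ℂ).toMatrix_orthonormalBasis_mem_unitary b, ?_⟩
  ext i j
  rw [mul_diagonal]
  change F i j = b j i * d j
  by_cases hj : d j = 0
  · have : f j = 0 := by
      rw [← inner_self_eq_zero (𝕜 := ℂ), hf]
      simp [hj]
    simpa [hj] using congrArg (fun v : EuclideanSpace ℂ n => v i) this
  · have hj' : (d j : ℂ) ≠ 0 := by exact_mod_cast hj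
    rw [hb j hj]
    simp [g, f]
    field_simp

open Matrix in
/-- **Singular value decomposition** of a complex square matrix, in which the singular values
are indexed as the eigenvalues of `Aᴴ * A`. -/
theorem exists_singularValueDecomposition {n : Type*} [Fintype n] [DecidableEq n]
    (A : Matrix n n ℂ) :
    ∃ U ∈ unitaryGroup n ℂ, ∃ V ∈ unitaryGroup n ℂ, A = U * (diagonal fun i =>
      (Real.sqrt ((posSemidef_conjTranspose_mul_self A).1.eigenvalues i) : ℂ)) * Vᴴ := by
  set hA := posSemidef_conjTranspose_mul_self A
  set V : Matrix n n ℂ := (hA.1.eigenvectorUnitary : Matrix n n ℂ)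
  have hV : V ∈ unitaryGroup n ℂ := hA.1.eigenvectorUnitary.2
  have hVV : Vᴴ * V = 1 := mem_unitaryGroup_iff'.1 hV
  have hVV' : V * Vᴴ = 1 := mem_unitaryGroup_iff.1 hV
  have hspec : Aᴴ * A = V * diagonal (fun i => (hA.1.eigenvalues i : ℂ)) * Vᴴ :=
    hA.1.spectral_theorem
  have hgram : (A * V)ᴴ * (A * V) =
      diagonal fun i => ((Real.sqrt (hA.1.eigenvalues i) ^ 2 : ℝ) : ℂ) := by
    simp only [Real.sq_sqrt (hA.eigenvalues_nonneg _)]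
    calc (A * V)ᴴ * (A * V) = Vᴴ * (Aᴴ * A) * V := by
          simp only [conjTranspose_mul, Matrix.mul_assoc]
      _ = (Vᴴ * V) * diagonal (fun i => (hA.1.eigenvalues i : ℂ)) * (Vᴴ * V) := by
          refine (congrArg (fun M => Vᴴ * M * V) hspec).trans ?_
          simp only [Matrix.mul_assoc]
      _ = _ := by simp [hVV]
  obtain ⟨U, hU, hAV⟩ := exists_unitary_mul_diagonal_of_gram _ _ hgram
  refine ⟨U, hU, V, hV, ?_⟩
  rw [← hAV, Matrix.mul_assoc, hVV', Matrix.mul_one]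

open Matrix in
theorem traceAbsRpow_unitary_mul_diagonal_mul {n : Type*} [Fintype n] [DecidableEq n]
    {U V : Matrix n n ℂ} (hU : U ∈ unitaryGroup n ℂ) (hV : V ∈ unitaryGroup n ℂ)
    {d : n → ℝ} (hd : ∀ i, 0 ≤ d i) (r : ℝ) :
    traceAbsRpow (U * (diagonal fun i => (d i : ℂ)) * Vᴴ) r = ∑ i, d i ^ r := by
  have hUU : Uᴴ * U = 1 := mem_unitaryGroup_iff'.1 hU
  have hVV : Vᴴ * V = 1 := mem_unitaryGroup_iff'.1 hV
  set M := U * (diagonal fun i => (d i : ℂ)) * Vᴴ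
  have hM : Mᴴ * M = V * (diagonal fun i => ((d i ^ 2 : ℝ) : ℂ)) * Vᴴ := by
    calc Mᴴ * M = V * (diagonal fun i => (d i : ℂ))ᴴ * (Uᴴ * U) *
          (diagonal fun i => (d i : ℂ)) * Vᴴ := by
          simp only [M, conjTranspose_mul, conjTranspose_conjTranspose, Matrix.mul_assoc]
      _ = _ := by
          rw [hUU, Matrix.mul_one, Matrix.mul_assoc V, diagonal_conjTranspose,
            diagonal_mul_diagonal]
          simp [sq]
  have hroots : (Mᴴ * M).charpoly.roots =
      Multiset.map (fun i => ((d i ^ 2 : ℝ) : ℂ)) Finset.univ.val := by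
    rw [hM, charpoly_mul_comm, ← Matrix.mul_assoc, hVV, Matrix.one_mul, charpoly_diagonal,
      Polynomial.roots_prod _ _
        (Finset.prod_ne_zero_iff.2 fun _ _ => Polynomial.X_sub_C_ne_zero _)]
    simp only [Polynomial.roots_X_sub_C, Multiset.bind_singleton]
  rw [(posSemidef_conjTranspose_mul_self M).1.roots_charpoly_eq_eigenvalues] at hroots
  have := congrArg (fun s => (s.map fun z : ℂ => Real.sqrt z.re ^ r).sum) hroots
  simp only [Multiset.map_map, Function.comp_def, Complex.ofReal_re, Real.sqrt_sq (hd _)] at this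
  exact this

open Matrix in
theorem sum_norm_sq_row_of_mem_unitaryGroup {n : Type*} [Fintype n] [DecidableEq n]
    {U : Matrix n n ℂ} (hU : U ∈ unitaryGroup n ℂ) (i : n) : ∑ j, ‖U i j‖ ^ 2 = 1 := by
  have h := congrFun (congrFun (mem_unitaryGroup_iff.1 hU) i) i
  simp only [mul_apply, star_apply, one_apply_eq, RCLike.star_def, Complex.mul_conj'] at h
  exact_mod_cast h

open Matrix in
theorem sum_norm_sq_col_of_mem_unitaryGroup {n : Type*} [Fintype n] [DecidableEq n]
    {U : Matrix n n ℂ} (hU : U ∈ unitaryGroup n ℂ) (j : n) : ∑ i, ‖U i j‖ ^ 2 = 1 := by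
  simpa using sum_norm_sq_row_of_mem_unitaryGroup (Unitary.star_mem hU) j

/-- Hölder's inequality for the bilinear form of a doubly stochastic matrix. -/
theorem sum_mul_mul_le_of_mem_doublyStochastic {n : Type*} [Fintype n] [DecidableEq n]
    {p q : ℝ} (hpq : p.HolderConjugate q) {w : Matrix n n ℝ} (hw : w ∈ doublyStochastic ℝ n)
    {s t : n → ℝ} (hs : ∀ i, 0 ≤ s i) (ht : ∀ i, 0 ≤ t i) :
    ∑ i, ∑ j, s i * w i j * t j ≤ (∑ i, s i ^ p) ^ (1 / p) * (∑ j, t j ^ q) ^ (1 / q) := by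
  obtain ⟨hw0, hrow, hcol⟩ := mem_doublyStochastic_iff_sum.1 hw
  have key := Real.inner_le_Lp_mul_Lq_of_nonneg (Finset.univ : Finset (n × n)) hpq
    (f := fun x => s x.1 * w x.1 x.2 ^ (1 / p)) (g := fun x => t x.2 * w x.1 x.2 ^ (1 / q))
    (fun x _ => mul_nonneg (hs _) (Real.rpow_nonneg (hw0 _ _) _))
    (fun x _ => mul_nonneg (ht _) (Real.rpow_nonneg (hw0 _ _) _))
  have hpow {r : ℝ} (hr : r ≠ 0) {a b : ℝ} (ha : 0 ≤ a) (hb : 0 ≤ b) :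
      (a * b ^ (1 / r)) ^ r = a ^ r * b := by
    rw [Real.mul_rpow ha (Real.rpow_nonneg hb _), ← Real.rpow_mul hb, one_div_mul_cancel hr,
      Real.rpow_one]
  have hmul (i j : n) : s i * w i j ^ (1 / p) * (t j * w i j ^ (1 / q)) = s i * w i j * t j := by
    have : w i j ^ (1 / p) * w i j ^ (1 / q) = w i j := by
      rw [← Real.rpow_add_of_nonneg (hw0 i j) hpq.one_div_nonneg hpq.symm.one_div_nonneg,
        one_div, one_div, hpq.inv_add_inv_eq_one, Real.rpow_one]
    linear_combination s i * t j * this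
  simp only [Fintype.sum_prod_type, hmul, hpow hpq.ne_zero (hs _) (hw0 _ _),
    hpow hpq.symm.ne_zero (ht _) (hw0 _ _)] at key
  rw [Finset.sum_comm (f := fun i j => t j ^ q * w i j)] at key
  simpa only [← Finset.mul_sum, hrow, hcol, mul_one] using key

open Matrix in
/-- **Hölder's inequality** for the Schatten norms. -/
theorem norm_trace_mul_le_traceAbsRpow {n : Type*} [Fintype n] [DecidableEq n]
    {p q : ℝ} (hpq : p.HolderConjugate q) (A B : Matrix n n ℂ) :
    ‖(A * B).trace‖ ≤ traceAbsRpow A p ^ (1 / p) * traceAbsRpow B q ^ (1 / q) := by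
  obtain ⟨U, hU, V, hV, hA⟩ := exists_singularValueDecomposition A
  obtain ⟨W, hW, X, hX, hB⟩ := exists_singularValueDecomposition B
  unfold traceAbsRpow
  set s : n → ℝ := fun i => Real.sqrt ((posSemidef_conjTranspose_mul_self A).1.eigenvalues i)
  set t : n → ℝ := fun i => Real.sqrt ((posSemidef_conjTranspose_mul_self B).1.eigenvalues i)
  set P := Vᴴ * W
  set Q := Xᴴ * U
  have hP : P ∈ unitaryGroup n ℂ := mul_mem (Unitary.star_mem hV) hW
  have hQ : Q ∈ unitaryGroup n ℂ := mul_mem (Unitary.star_mem hX) hU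
  have htr : (A * B).trace = ∑ i, ∑ j, (s i : ℂ) * P i j * (t j * Q j i) := by
    calc (A * B).trace
        = (((diagonal fun i => (s i : ℂ)) * P) * ((diagonal fun i => (t i : ℂ)) * Q)).trace := by
          rw [hA, hB, Matrix.mul_assoc U, Matrix.mul_assoc U, trace_mul_comm U]
          simp only [P, Q, s, t, Matrix.mul_assoc]
      _ = _ := Finset.sum_congr rfl fun i _ => by
          rw [diag_apply, mul_apply]
          simp only [diagonal_mul]
  let w : Matrix n n ℝ := of fun i j => (‖P i j‖ ^ 2 + ‖Q j i‖ ^ 2) / 2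
  have hw : w ∈ doublyStochastic ℝ n := by
    refine mem_doublyStochastic_iff_sum.2 ⟨fun i j => ?_, fun i => ?_, fun j => ?_⟩
    · simp only [w, of_apply]; positivity
    · simp only [w, of_apply, ← Finset.sum_div, Finset.sum_add_distrib,
        sum_norm_sq_row_of_mem_unitaryGroup hP, sum_norm_sq_col_of_mem_unitaryGroup hQ]
      norm_num
    · simp only [w, of_apply, ← Finset.sum_div, Finset.sum_add_distrib,
        sum_norm_sq_row_of_mem_unitaryGroup hQ, sum_norm_sq_col_of_mem_unitaryGroup hP]
      norm_num
  have hs (i : n) : 0 ≤ s i := Real.sqrt_nonneg _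
  have ht (i : n) : 0 ≤ t i := Real.sqrt_nonneg _
  refine le_trans ?_ (sum_mul_mul_le_of_mem_doublyStochastic hpq hw hs ht)
  rw [htr]
  refine (norm_sum_le _ _).trans (Finset.sum_le_sum fun i _ => ?_)
  refine (norm_sum_le _ _).trans (Finset.sum_le_sum fun j _ => ?_)
  simp only [norm_mul, Complex.norm_real, Real.norm_of_nonneg (hs i), Real.norm_of_nonneg (ht j)]
  have hPQ : ‖P i j‖ * ‖Q j i‖ ≤ w i j := by
    simp only [w, of_apply]
    linarith [two_mul_le_add_sq ‖P i j‖ ‖Q j i‖]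
  calc s i * ‖P i j‖ * (t j * ‖Q j i‖) = s i * t j * (‖P i j‖ * ‖Q j i‖) := by ring
    _ ≤ s i * t j * w i j := mul_le_mul_of_nonneg_left hPQ (mul_nonneg (hs i) (ht j))
    _ = s i * w i j * t j := by ring

theorem traceAbsRpow_nonneg {n : Type*} [Fintype n] [DecidableEq n]
    (A : Matrix n n ℂ) (r : ℝ) : 0 ≤ traceAbsRpow A r :=
  Finset.sum_nonneg fun _ _ => Real.rpow_nonneg (Real.sqrt_nonneg _) _

open Matrix in
/-- The Hölder bound for the Schatten norms is attained. -/
theorem exists_norm_trace_mul_eq_traceAbsRpow {n : Type*} [Fintype n] [DecidableEq n]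
    {p q : ℝ} (hpq : p.HolderConjugate q) (A : Matrix n n ℂ) :
    ∃ B : Matrix n n ℂ, traceAbsRpow B q ≤ 1 ∧
      traceAbsRpow A p ^ (1 / p) = ‖(A * B).trace‖ := by
  obtain ⟨U, hU, V, hV, hA⟩ := exists_singularValueDecomposition A
  set s : n → ℝ := fun i => Real.sqrt ((posSemidef_conjTranspose_mul_self A).1.eigenvalues i)
  have hs (i : n) : 0 ≤ s i := Real.sqrt_nonneg _
  set N := traceAbsRpow A p
  have hN : N = ∑ i, s i ^ p := rfl
  have hN0 : 0 ≤ N := traceAbsRpow_nonneg A p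
  let t : n → ℝ := fun i => s i ^ (p - 1) / N ^ (1 / q)
  have ht (i : n) : 0 ≤ t i := by positivity [hs i]
  refine ⟨V * (diagonal fun i => (t i : ℂ)) * Uᴴ, ?_, ?_⟩
  · have htq (i : n) : t i ^ q = s i ^ p / N := by
      rw [Real.div_rpow (Real.rpow_nonneg (hs i) _) (Real.rpow_nonneg hN0 _),
        ← Real.rpow_mul (hs i), ← Real.rpow_mul hN0, hpq.sub_one_mul_conj, one_div_mul_cancel hpq.symm.ne_zero,
        Real.rpow_one]
    rw [traceAbsRpow_unitary_mul_diagonal_mul hV hU ht]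
    simp only [htq, ← Finset.sum_div, ← hN]
    exact div_self_le_one N
  · have hst (i : n) : s i * t i = s i ^ p / N ^ (1 / q) := by
      rw [mul_div_assoc', ← Real.rpow_one_add' (hs i) (by simpa using hpq.ne_zero),
        add_sub_cancel]
    have hNN : N ^ (1 / p) = N / N ^ (1 / q) := by
      rcases hN0.eq_or_lt with h | h
      · rw [← h, zero_div, Real.zero_rpow (one_div_ne_zero hpq.ne_zero)]
      · rw [eq_div_iff (by positivity), ← Real.rpow_add h, one_div, one_div,
          hpq.inv_add_inv_eq_one, Real.rpow_one]
    have htr : (A * (V * (diagonal fun i => (t i : ℂ)) * Uᴴ)).trace =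
        ((N / N ^ (1 / q) : ℝ) : ℂ) := by
      calc _ = ((diagonal fun i => (s i : ℂ)) * (Vᴴ * V) * (diagonal fun i => (t i : ℂ)) *
            (Uᴴ * U)).trace := by
            conv_lhs => rw [hA, Matrix.mul_assoc U, Matrix.mul_assoc U, trace_mul_comm U]
            simp only [Matrix.mul_assoc, s]
        _ = ((∑ i, s i * t i : ℝ) : ℂ) := by
            rw [← star_eq_conjTranspose, ← star_eq_conjTranspose, mem_unitaryGroup_iff'.1 hV,
              mem_unitaryGroup_iff'.1 hU, Matrix.mul_one, Matrix.mul_one, diagonal_mul_diagonal,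
              trace_diagonal]
            push_cast
            rfl
        _ = _ := by simp only [hst, ← Finset.sum_div, ← hN]
    rw [htr, hNN, Complex.norm_real, Real.norm_of_nonneg (by positivity)]

/-- Variational characterization (Hölder duality) of the Schatten `p`-norm of a matrix:
`(Tr |A|^p)^{1/p} = sup { |Tr (A B)| : Tr |B|^q ≤ 1 }` for conjugate exponents `p, q > 1`. -/
theorem stmt9 {n : Type*} [Fintype n] [DecidableEq n] [Nonempty n]
    (p q : ℝ) (hp : 1 < p) (hq : 1 < q) (hpq : 1 / p + 1 / q = 1)
    (A : Matrix n n ℂ) :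
    traceAbsRpow A p ^ (1 / p) =
      sSup {x : ℝ | ∃ B : Matrix n n ℂ, traceAbsRpow B q ≤ 1 ∧ x = ‖(A * B).trace‖} := by
  have hpq' : p.HolderConjugate q :=
    Real.holderConjugate_iff.2 ⟨hp, by simpa only [one_div] using hpq⟩
  symm
  refine IsGreatest.csSup_eq ⟨exists_norm_trace_mul_eq_traceAbsRpow hpq' A, ?_⟩
  rintro _ ⟨B, hB, rfl⟩
  refine (norm_trace_mul_le_traceAbsRpow hpq' A B).trans ?_
  exact mul_le_of_le_one_right (Real.rpow_nonneg (traceAbsRpow_nonneg A p) _)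
    (Real.rpow_le_one (traceAbsRpow_nonneg B q) hB hpq'.symm.one_div_nonneg)
end

section
/- Let n be a finite nonempty index type, let p > 1 be a real number, and for an n×n complex matrix M set ‖M‖_p = (Tr(|M|^p))^{1/p}, where |M| is the positive semidefinite square root of MᴴM and |M|^p its p-th power via the functional calculus. Then for all n×n complex matrices A and B, ‖A + B‖_p ≤ ‖A‖_p + ‖B‖_p (Minkowski's inequality for the Schatten p-norm). -/
open scoped ComplexOrder

open scoped InnerProductSpace

/-- If `T` maps an orthonormal basis `v` to the rescaled orthonormal basis `s i • u i` with
`s ≥ 0`, then the `p`-th power sum of any "diagonal" of `T` is at most `∑ i, s i ^ p`. -/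
theorem OrthonormalBasis.sum_norm_inner_map_rpow_le {ι E : Type*} [Fintype ι]
    [NormedAddCommGroup E] [InnerProductSpace ℂ E] {T : E →ₗ[ℂ] E}
    {v u : OrthonormalBasis ι ℂ E} {s : ι → ℝ} (hs : ∀ i, 0 ≤ s i)
    (hT : ∀ i, T (v i) = (s i : ℂ) • u i) (e f : OrthonormalBasis ι ℂ E)
    {p : ℝ} (hp : 1 ≤ p) :
    ∑ i, ‖⟪f i, T (e i)⟫_ℂ‖ ^ p ≤ ∑ i, s i ^ p := by
  set w : ι → ι → ℝ := fun i k => (‖⟪v k, e i⟫_ℂ‖ ^ 2 + ‖⟪f i, u k⟫_ℂ‖ ^ 2) / 2 with hw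
  have hw0 : ∀ i k, 0 ≤ w i k := fun i k => by positivity
  have hrow : ∀ i, ∑ k, w i k = 1 := fun i => by
    simp only [hw, ← Finset.sum_div, Finset.sum_add_distrib, v.sum_sq_norm_inner_right,
      u.sum_sq_norm_inner_left, e.norm_eq_one, f.norm_eq_one]
    norm_num
  have hcol : ∀ k, ∑ i, w i k = 1 := fun k => by
    simp only [hw, ← Finset.sum_div, Finset.sum_add_distrib, e.sum_sq_norm_inner_left,
      f.sum_sq_norm_inner_right, v.norm_eq_one, u.norm_eq_one]
    norm_num
  have hdiag : ∀ i, ‖⟪f i, T (e i)⟫_ℂ‖ ≤ ∑ k, w i k * s k := fun i => by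
    have hexp : ⟪f i, T (e i)⟫_ℂ = ∑ k, ⟪v k, e i⟫_ℂ * (s k * ⟪f i, u k⟫_ℂ) := by
      conv_lhs => rw [← v.sum_repr' (e i)]
      simp only [map_sum, map_smul, hT, inner_sum, inner_smul_right]
    rw [hexp]
    refine (norm_sum_le _ _).trans (Finset.sum_le_sum fun k _ => ?_)
    rw [norm_mul, norm_mul, Complex.norm_of_nonneg (hs k)]
    have := mul_nonneg (hs k) (sq_nonneg (‖⟪v k, e i⟫_ℂ‖ - ‖⟪f i, u k⟫_ℂ‖))
    simp only [hw]
    linarith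
  calc ∑ i, ‖⟪f i, T (e i)⟫_ℂ‖ ^ p
      ≤ ∑ i, ∑ k, w i k * s k ^ p := by
        refine Finset.sum_le_sum fun i _ => ?_
        exact (Real.rpow_le_rpow (norm_nonneg _) (hdiag i) (by linarith)).trans
          (Real.rpow_arith_mean_le_arith_mean_rpow _ _ _ (fun k _ => hw0 i k) (hrow i)
            (fun k _ => hs k) hp)
    _ = ∑ k, s k ^ p := by
        rw [Finset.sum_comm]
        simp only [← Finset.sum_mul, hcol, one_mul]

/-- Singular value decomposition of a square complex matrix. -/
theorem Matrix.exists_orthonormalBasis_toEuclideanLin_eq_smul {n : Type*} [Fintype n]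
    [DecidableEq n] (A : Matrix n n ℂ) :
    ∃ v u : OrthonormalBasis n ℂ (EuclideanSpace ℂ n), ∀ i, A.toEuclideanLin (v i) =
      (Real.sqrt ((Matrix.posSemidef_conjTranspose_mul_self A).1.eigenvalues i) : ℂ) • u i := by
  set hA := Matrix.posSemidef_conjTranspose_mul_self A
  set v := hA.1.eigenvectorBasis
  set s : n → ℝ := fun i => Real.sqrt (hA.1.eigenvalues i)
  have hinner : ∀ i j, ⟪A.toEuclideanLin (v i), A.toEuclideanLin (v j)⟫_ℂ =
      (s j : ℂ) ^ 2 * if i = j then 1 else 0 := fun i j => by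
    have hv : A.conjTranspose.toEuclideanLin (A.toEuclideanLin (v j)) =
        (hA.1.eigenvalues j : ℂ) • v j := by
      have := hA.1.mulVec_eigenvectorBasis j
      rw [← Matrix.mulVec_mulVec] at this
      ext k
      simpa using! congrFun this k
    rw [← LinearMap.adjoint_inner_right, ← Matrix.toEuclideanLin_conjTranspose_eq_adjoint, hv,
      inner_smul_right, orthonormal_iff_ite.mp v.orthonormal i j, ← Complex.ofReal_pow,
      Real.sq_sqrt (hA.eigenvalues_nonneg j)]
  have horth : Orthonormal ℂ
      (({i | s i ≠ 0} : Set n).domRestrict fun i => (s i : ℂ)⁻¹ • A.toEuclideanLin (v i)) := by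
    rw [orthonormal_iff_ite]
    rintro ⟨i, hi⟩ ⟨j, hj⟩
    have hj' : (s j : ℂ) ≠ 0 := Complex.ofReal_ne_zero.mpr hj
    simp only [Set.domRestrict_apply, inner_smul_left, inner_smul_right, hinner, Subtype.mk.injEq]
    split_ifs with hij
    · subst hij
      simp only [map_inv₀, Complex.conj_ofReal]
      field_simp
    · simp
  obtain ⟨u, hu⟩ := horth.exists_orthonormalBasis_extension_of_card_eq (by simp)
  refine ⟨v, u, fun i => ?_⟩
  change _ = (s i : ℂ) • u i
  by_cases hi : s i = 0
  · rw [hi, Complex.ofReal_zero, zero_smul, ← inner_self_eq_zero (𝕜 := ℂ), hinner, hi]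
    simp
  · rw [hu i hi, smul_inv_smul₀ (Complex.ofReal_ne_zero.mpr hi)]

/-- Minkowski's inequality for the Schatten `p`-norm of complex matrices:
`‖A + B‖_p ≤ ‖A‖_p + ‖B‖_p` where `‖M‖_p = (Tr |M|^p)^{1/p}`. -/
theorem stmt10 {n : Type*} [Fintype n] [DecidableEq n] [Nonempty n]
    (p : ℝ) (hp : 1 < p) (A B : Matrix n n ℂ) :
    traceAbsRpow (A + B) p ^ (1 / p) ≤
      traceAbsRpow A p ^ (1 / p) + traceAbsRpow B p ^ (1 / p) := by
  obtain ⟨vA, uA, hA⟩ := A.exists_orthonormalBasis_toEuclideanLin_eq_smul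
  obtain ⟨vB, uB, hB⟩ := B.exists_orthonormalBasis_toEuclideanLin_eq_smul
  obtain ⟨v, u, hAB⟩ := (A + B).exists_orthonormalBasis_toEuclideanLin_eq_smul
  have hp0 : 0 ≤ 1 / p := by positivity
  set a : n → ℝ := fun i => ‖⟪u i, A.toEuclideanLin (v i)⟫_ℂ‖
  set b : n → ℝ := fun i => ‖⟪u i, B.toEuclideanLin (v i)⟫_ℂ‖
  have ha : ∑ i, a i ^ p ≤ traceAbsRpow A p :=
    OrthonormalBasis.sum_norm_inner_map_rpow_le (fun _ => Real.sqrt_nonneg _) hA v u hp.le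
  have hb : ∑ i, b i ^ p ≤ traceAbsRpow B p :=
    OrthonormalBasis.sum_norm_inner_map_rpow_le (fun _ => Real.sqrt_nonneg _) hB v u hp.le
  have hab : traceAbsRpow (A + B) p ≤ ∑ i, (a i + b i) ^ p := by
    refine Finset.sum_le_sum fun i _ => Real.rpow_le_rpow (Real.sqrt_nonneg _) ?_ (by linarith)
    have hs := Real.sqrt_nonneg
      ((Matrix.posSemidef_conjTranspose_mul_self (A + B)).1.eigenvalues i)
    have hi := hAB i
    generalize Real.sqrt
      ((Matrix.posSemidef_conjTranspose_mul_self (A + B)).1.eigenvalues i) = t at hs hi ⊢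
    have h := congrArg (fun x => ‖⟪u i, x⟫_ℂ‖) hi
    simp only [inner_smul_right, inner_self_eq_norm_sq_to_K, u.norm_eq_one, norm_mul,
      Complex.norm_of_nonneg hs, map_add, LinearMap.add_apply,
      inner_add_right] at h
    norm_num at h
    rw [← h]
    exact norm_add_le _ _
  calc traceAbsRpow (A + B) p ^ (1 / p)
      ≤ (∑ i, (a i + b i) ^ p) ^ (1 / p) :=
        Real.rpow_le_rpow (Finset.sum_nonneg fun _ _ => by positivity) hab hp0
    _ ≤ (∑ i, a i ^ p) ^ (1 / p) + (∑ i, b i ^ p) ^ (1 / p) :=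
        Real.Lp_add_le_of_nonneg _ hp.le (fun _ _ => norm_nonneg _) fun _ _ => norm_nonneg _
    _ ≤ traceAbsRpow A p ^ (1 / p) + traceAbsRpow B p ^ (1 / p) := by
        gcongr
end

section
/- Let (h_i)_{i∈ℕ} be a sequence of real numbers. Then the following are equivalent: (a) there exists a bounded operator T : H → H that is injective, has dense range, is Hilbert–Schmidt, and satisfies |T| e_i = e^{-h_i/2} · e_i for all i ∈ ℕ, where |T| is the positive square root of T*T; (b) the series ∑_{i∈ℕ} e^{-h_i} converges. (A Hamiltonian h with discrete spectrum (h_i) admits a thermal equilibrium (KMS) state in this setting if and only if e^{-h/2} is Hilbert–Schmidt.) -/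
/-- The absolute value `|M| = (M* M)^{1/2}` of a bounded operator, via the continuous
functional calculus in the C*-algebra of bounded operators. -/
noncomputable def absOp {H : Type*} [NormedAddCommGroup H] [InnerProductSpace ℂ H]
    [CompleteSpace H] (M : H →L[ℂ] H) : H →L[ℂ] H :=
  CFC.sqrt (ContinuousLinearMap.adjoint M ∘L M)

open ContinuousLinearMap in
theorem absOp_mul_absOp {H : Type*} [NormedAddCommGroup H] [InnerProductSpace ℂ H]
    [CompleteSpace H] (M : H →L[ℂ] H) : absOp M * absOp M = adjoint M ∘L M :=
  CFC.sqrt_mul_sqrt_self _ ((nonneg_iff_isPositive _).2 (isPositive_adjoint_comp_self M))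

open ContinuousLinearMap in
theorem absOp_of_isPositive {H : Type*} [NormedAddCommGroup H] [InnerProductSpace ℂ H]
    [CompleteSpace H] {M : H →L[ℂ] H} (hM : M.IsPositive) : absOp M = M := by
  refine CFC.sqrt_unique ?_ ((nonneg_iff_isPositive _).2 hM)
  rw [hM.isSymmetric.clm_adjoint_eq]
  rfl

open ContinuousLinearMap in
theorem norm_absOp_apply {H : Type*} [NormedAddCommGroup H] [InnerProductSpace ℂ H]
    [CompleteSpace H] (M : H →L[ℂ] H) (x : H) : ‖absOp M x‖ = ‖M x‖ := by
  have hpos : (absOp M).IsPositive := (nonneg_iff_isPositive _).1 (CFC.sqrt_nonneg _)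
  have h : inner ℂ (absOp M x) (absOp M x) = inner ℂ (M x) (M x) := by
    rw [← adjoint_inner_right M, ← adjoint_inner_right (absOp M), hpos.isSymmetric.clm_adjoint_eq]
    exact congrArg (fun A : H →L[ℂ] H => inner ℂ x (A x)) (absOp_mul_absOp M)
  rw [inner_self_eq_norm_sq_to_K, inner_self_eq_norm_sq_to_K] at h
  exact (sq_eq_sq₀ (norm_nonneg _) (norm_nonneg _)).1 (by exact_mod_cast h)

open scoped ComplexOrder in
/-- A bounded nonnegative sequence is the diagonal of a positive operator. -/
theorem HilbertBasis.exists_isPositive_diagonal {ι H : Type*} [NormedAddCommGroup H]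
    [InnerProductSpace ℂ H] [CompleteSpace H] (e : HilbertBasis ι ℂ H) {a : ι → ℝ}
    (ha : ∀ i, 0 ≤ a i) {C : ℝ} (hC : ∀ i, a i ≤ C) :
    ∃ D : H →L[ℂ] H, D.IsPositive ∧ ∀ x i, e.repr (D x) i = (a i : ℂ) * e.repr x i := by
  have hmem (x : H) : Memℓp (fun i => (a i : ℂ) * e.repr x i) 2 := by
    refine (lp.memℓp (C • e.repr x)).mono' fun i => ?_
    have h0 := (ha i).trans (hC i)
    rw [lp.coeFn_smul, Pi.smul_apply, norm_smul, norm_mul, Complex.norm_real, Real.norm_eq_abs,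
      Real.norm_eq_abs, abs_of_nonneg (ha i), abs_of_nonneg h0]
    exact mul_le_mul_of_nonneg_right (hC i) (norm_nonneg _)
  let L : H →ₗ[ℂ] H :=
    { toFun := fun x => e.repr.symm ⟨fun i => (a i : ℂ) * e.repr x i, hmem x⟩
      map_add' := fun x y => by
        rw [← map_add]
        congr 1
        ext i
        simp only [map_add, lp.coeFn_add, Pi.add_apply, mul_add]
      map_smul' := fun c x => by
        rw [RingHom.id_apply, ← map_smul]
        congr 1
        ext i
        simp [mul_left_comm] }
  have hL (x : H) (i : ι) : e.repr (L x) i = (a i : ℂ) * e.repr x i := by simp [L]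
  have hsymm : L.IsSymmetric := fun x y => by
    rw [← e.repr.inner_map_map, ← e.repr.inner_map_map x, lp.inner_eq_tsum, lp.inner_eq_tsum]
    refine tsum_congr fun i => ?_
    simp only [hL, RCLike.inner_apply, map_mul, Complex.conj_ofReal]
    ring
  refine ⟨⟨L, hsymm.continuous⟩, (ContinuousLinearMap.isPositive_iff _).2 ⟨hsymm, fun x => ?_⟩, hL⟩
  change 0 ≤ inner ℂ (L x) x
  rw [← e.repr.inner_map_map, lp.inner_eq_tsum]
  refine tsum_nonneg fun i => ?_
  rw [hL, RCLike.inner_apply, map_mul, Complex.conj_ofReal, mul_left_comm, RCLike.mul_conj]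
  exact mul_nonneg (Complex.zero_le_real.2 (ha i))
    (pow_nonneg (RCLike.ofReal_nonneg.2 (norm_nonneg _)) 2)

/-- A Hamiltonian with discrete spectrum `(h i)` admits a thermal equilibrium (KMS) state in
this setting if and only if `e^{-h/2}` is Hilbert–Schmidt: there exists an injective,
dense-range, Hilbert–Schmidt operator `T` with `|T| (e i) = e^{-h i / 2} • e i` for all `i`
if and only if `∑ i, e^{-h i}` converges. -/
theorem stmt13 {H : Type*} [NormedAddCommGroup H] [InnerProductSpace ℂ H] [CompleteSpace H]
    (e : HilbertBasis ℕ ℂ H) (h : ℕ → ℝ) :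
    (∃ T : H →L[ℂ] H, Function.Injective T ∧ DenseRange T ∧
        (Summable fun i : ℕ => ‖T (e i)‖ ^ 2) ∧
        ∀ i : ℕ, (absOp T) (e i) = (Real.exp (-h i / 2) : ℂ) • e i) ↔
      Summable fun i : ℕ => Real.exp (-h i) := by
  have hexp (t : ℝ) : ‖(Real.exp (-t / 2) : ℂ)‖ ^ 2 = Real.exp (-t) := by
    rw [Complex.norm_real, Real.norm_of_nonneg (Real.exp_pos _).le, ← Real.exp_nat_mul]
    congr 1
    push_cast
    ring
  constructor
  · rintro ⟨T, -, -, hT, habs⟩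
    refine hT.congr fun i => ?_
    rw [← norm_absOp_apply, habs, norm_smul, e.orthonormal.1, mul_one, hexp]
  · intro hs
    have hbound (i : ℕ) : Real.exp (-h i / 2) ≤ 1 + ∑' j, Real.exp (-h j) := by
      have h1 := hs.le_tsum i fun j _ => (Real.exp_pos (-h j)).le
      have h2 := hexp (h i)
      rw [Complex.norm_real, Real.norm_of_nonneg (Real.exp_pos _).le] at h2
      nlinarith [sq_nonneg (Real.exp (-h i / 2) - 1)]
    obtain ⟨D, hpos, hD⟩ := e.exists_isPositive_diagonal (fun i => (Real.exp_pos (-h i / 2)).le)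
      hbound
    have hDe (i : ℕ) : D (e i) = (Real.exp (-h i / 2) : ℂ) • e i := by
      apply e.repr.injective
      ext j
      rw [hD, map_smul, e.repr_self, lp.coeFn_smul, Pi.smul_apply, smul_eq_mul]
      rcases eq_or_ne j i with rfl | hij
      · rfl
      · simp [hij]
    refine ⟨D, ?_, ?_, ?_, ?_⟩
    · refine (injective_iff_map_eq_zero D).2 fun x hx => e.repr.injective ?_
      ext i
      have h0 := hD x i
      rw [hx, map_zero] at h0
      simpa [Complex.exp_ne_zero] using h0.symm
    · have hle : Submodule.span ℂ (Set.range e) ≤ D.range := by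
        rw [Submodule.span_le]
        rintro _ ⟨i, rfl⟩
        refine ⟨(Real.exp (-h i / 2) : ℂ)⁻¹ • e i, ?_⟩
        change D _ = _
        rw [map_smul, hDe, inv_smul_smul₀]
        exact_mod_cast (Real.exp_pos _).ne'
      have hd := (Submodule.dense_iff_topologicalClosure_eq_top.2 e.dense_span).mono hle
      exact hd
    · refine hs.congr fun i => ?_
      rw [hDe, norm_smul, e.orthonormal.1, mul_one, hexp]
    · rw [absOp_of_isPositive hpos]
      exact hDe
end

section
/- Let T : H → H be an injective bounded linear operator, and let U, V : H → H be unitary operators such that T = U ∘ |T| and T* = V ∘ |T*|, where |M| denotes the positive square root of M*M. Then V = U* (the unitary part of the polar decomposition of T* is the adjoint of the unitary part of the polar decomposition of T). -/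
/-- If `T = U P` with `U` unitary and `P` positive, then `|T*| = U P U*`. -/
theorem absOp_adjoint_of_eq_unitary_mul {H : Type*} [NormedAddCommGroup H]
    [InnerProductSpace ℂ H] [CompleteSpace H] {T U P : H →L[ℂ] H}
    (hU : U ∈ unitary (H →L[ℂ] H)) (hP : 0 ≤ P) (hT : T = U * P) :
    absOp (ContinuousLinearMap.adjoint T) = U * P * star U := by
  have hPs : star P = P := (IsSelfAdjoint.of_nonneg hP).star_eq
  refine CFC.sqrt_unique ?_ (star_right_conjugate_nonneg hP U)
  rw [ContinuousLinearMap.adjoint_adjoint, ← ContinuousLinearMap.star_eq_adjoint]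
  change _ = T * star T
  rw [hT, star_mul, hPs]
  calc U * P * star U * (U * P * star U) = U * P * (star U * U) * P * star U := by
        simp only [mul_assoc]
    _ = U * P * (P * star U) := by
        rw [Unitary.star_mul_self_of_mem hU, mul_one, mul_assoc]

/-- If `T` is an injective bounded operator with polar decompositions `T = U |T|` and
`T* = V |T*|` where `U` and `V` are unitary, then `V = U*`. -/
theorem stmt14 {H : Type*} [NormedAddCommGroup H] [InnerProductSpace ℂ H] [CompleteSpace H]
    (T U V : H →L[ℂ] H) (hT : Function.Injective T)
    (hU : U ∈ unitary (H →L[ℂ] H)) (hV : V ∈ unitary (H →L[ℂ] H))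
    (hTU : T = U ∘L absOp T)
    (hTV : ContinuousLinearMap.adjoint T = V ∘L absOp (ContinuousLinearMap.adjoint T)) :
    V = ContinuousLinearMap.adjoint U := by
  have hP0 : 0 ≤ absOp T := CFC.sqrt_nonneg _
  have hP : star (absOp T) = absOp T := (IsSelfAdjoint.of_nonneg hP0).star_eq
  have hUU : star U * U = 1 := Unitary.star_mul_self_of_mem hU
  have hUU' : U * star U = 1 := Unitary.mul_star_self_of_mem hU
  have hTU' : T = U * absOp T := hTU
  have hTs : star T = absOp T * star U := by
    conv_lhs => rw [hTU', star_mul, hP]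
  have habs : absOp (ContinuousLinearMap.adjoint T) = U * absOp T * star U :=
    absOp_adjoint_of_eq_unitary_mul hU hP0 hTU'
  have hVUP : V * U * absOp T = absOp T := by
    have h : absOp T * star U = V * (U * absOp T * star U) := by
      rw [← hTs, ← habs]
      exact hTV
    calc V * U * absOp T = V * (U * absOp T * star U) * U := by
          simp only [mul_assoc, hUU, mul_one]
      _ = absOp T := by rw [← h, mul_assoc, hUU, mul_one]
  have hPinj : Function.Injective (absOp T) := by
    have h : Function.Injective (U ∘ absOp T) := by
      rw [hTU] at hT
      exact hT
    exact h.of_comp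
  have hVU : V * U = 1 := by
    have h : absOp T * star (V * U) = absOp T * 1 := by
      rw [mul_one]
      conv_lhs => rw [← hP, ← star_mul, hVUP, hP]
    have h' : star (V * U) = 1 :=
      ContinuousLinearMap.ext fun x => hPinj (DFunLike.congr_fun h x)
    rw [← star_star (V * U), h', star_one]
  calc V = V * U * star U := by rw [mul_assoc, hUU', mul_one]
    _ = ContinuousLinearMap.adjoint U := by
      rw [hVU, one_mul, ContinuousLinearMap.star_eq_adjoint]
end

section
/- For a natural number k, let B_k be the (k+1)×(k+1) real symmetric tridiagonal matrix (indexed by 0 ≤ i, j ≤ k) with diagonal entries (B_k)_{ii} = 2k + 2, off-diagonal entries (B_k)_{i,i+1} = (B_k)_{i+1,i} = 2·√((i+1)(k−i)) for 0 ≤ i ≤ k−1, and all other entries 0. Then the characteristic polynomial of B_k is ∏_{j=0}^{k} (X − (4j + 2)); equivalently, the eigenvalues of B_k are exactly 2 + 4j for j = 0, 1, …, k, each simple. (These are the eigenvalues of the operator x² + y² of the Landau-level problem restricted to the k-th diagonal of states, so that confining to the disk x² + y² ≤ R² retains only finitely many diagonals.) -/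
open Polynomial in
/-- The polynomials `(1 + t)^a (1 - t)^b` are eigenvectors of `p ↦ (1 - t²) p' + (a + b) t p`. -/
lemma krawtchouk_derivative (a b : ℕ) :
    (1 - X ^ 2) * derivative ((1 + X) ^ a * (1 - X) ^ b : ℝ[X]) +
      ((a : ℝ[X]) + (b : ℝ[X])) * X * ((1 + X) ^ a * (1 - X) ^ b) =
      ((a : ℝ[X]) - (b : ℝ[X])) * ((1 + X) ^ a * (1 - X) ^ b) := by
  rcases a with _ | a <;> rcases b with _ | b <;>
    simp [derivative_pow] <;> ring

open Polynomial in
lemma krawtchouk_coeff_rec (a b n : ℕ) :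
    ((n : ℝ) + 1) * ((1 + X) ^ a * (1 - X) ^ b : ℝ[X]).coeff (n + 1) +
      ((a : ℝ) + b + 1 - n) * (X * ((1 + X) ^ a * (1 - X) ^ b) : ℝ[X]).coeff n =
      ((a : ℝ) - b) * ((1 + X) ^ a * (1 - X) ^ b : ℝ[X]).coeff n := by
  have h := krawtchouk_derivative a b
  generalize ((1 + X) ^ a * (1 - X) ^ b : ℝ[X]) = p at h ⊢
  have e : derivative p - X * (X * derivative p) + C ((a : ℝ) + b) * (X * p) =
      C ((a : ℝ) - b) * p := by
    simp only [C_add, C_sub, map_natCast]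
    linear_combination h
  have h := congrArg (fun q => q.coeff n) e
  simp only [coeff_add, coeff_sub, coeff_C_mul, coeff_derivative] at h
  rcases n with _ | _ | n
  · simp only [coeff_X_mul_zero, Nat.cast_zero] at h ⊢
    linear_combination h
  · simp only [coeff_X_mul, coeff_X_mul_zero] at h ⊢
    push_cast at h ⊢
    linear_combination h
  · simp only [coeff_X_mul, coeff_derivative] at h ⊢
    push_cast at h ⊢
    linear_combination h

open Polynomial in
lemma krawtchouk_coeff_eq_zero (a b n : ℕ) (h : a + b < n) :
    ((1 + X) ^ a * (1 - X) ^ b : ℝ[X]).coeff n = 0 := by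
  apply coeff_eq_zero_of_natDegree_lt
  refine lt_of_le_of_lt ?_ h
  compute_degree

lemma sqrt_mul_sqrt_factorial_succ (i m : ℕ) :
    √(((i : ℝ) + 1) * ((m + 1 : ℕ) : ℝ)) * √(((i + 1).factorial : ℝ) * (m.factorial : ℝ)) =
      ((i : ℝ) + 1) * √((i.factorial : ℝ) * ((m + 1).factorial : ℝ)) := by
  rw [← Real.sqrt_mul (by positivity)]
  conv_rhs => rw [← Real.sqrt_sq (show (0 : ℝ) ≤ (i : ℝ) + 1 by positivity)]
  rw [← Real.sqrt_mul (by positivity)]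
  congr 1
  simp only [Nat.factorial_succ]
  push_cast
  ring

lemma sqrt_mul_sqrt_factorial (i m : ℕ) :
    √(((i : ℝ) + 1) * ((m + 1 : ℕ) : ℝ)) * √((i.factorial : ℝ) * ((m + 1).factorial : ℝ)) =
      ((m : ℝ) + 1) * √(((i + 1).factorial : ℝ) * (m.factorial : ℝ)) := by
  have h := sqrt_mul_sqrt_factorial_succ m i
  push_cast at h ⊢
  rwa [mul_comm ((m : ℝ) + 1), mul_comm ((m + 1).factorial : ℝ),
    mul_comm (m.factorial : ℝ)] at h

lemma Fin.sum_ite_val_eq {M : Type*} [AddCommMonoid M] (n m : ℕ) (x : M) :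
    ∑ j : Fin n, (if (j : ℕ) = m then x else 0) = if m < n then x else 0 := by
  rw [Fin.sum_univ_eq_sum_range (fun j => if j = m then x else 0) n]
  simp

/-- A sum over `Fin n` supported on the neighbours `i - 1`, `i`, `i + 1` of `i`. -/
lemma Fin.sum_eq_of_tridiagonal {M : Type*} [AddCommMonoid M] {n : ℕ} (g : Fin n → M) (i : Fin n)
    (hzero : ∀ j : Fin n, i ≠ j → (i : ℕ) + 1 ≠ j → (j : ℕ) + 1 ≠ i → g j = 0) (u l : M)
    (hu : ∀ j : Fin n, (i : ℕ) + 1 = j → g j = u) (hu' : (i : ℕ) + 1 = n → u = 0)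
    (hl : ∀ j : Fin n, (j : ℕ) + 1 = i → g j = l) (hl' : (i : ℕ) = 0 → l = 0) :
    ∑ j, g j = g i + u + l := by
  have key (j : Fin n) : g j = (if (j : ℕ) = i then g i else 0) +
      (if (j : ℕ) = i + 1 then u else 0) +
      (if (j : ℕ) = i - 1 then (if (i : ℕ) = 0 then 0 else l) else 0) := by
    rcases eq_or_ne i j with rfl | h1
    · rcases Nat.eq_zero_or_pos (i : ℕ) with h | h
      · simp [h]
      · simp [show (i : ℕ) ≠ i - 1 by omega]
    have h1' : (j : ℕ) ≠ i := fun h => h1 (Fin.ext h.symm)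
    by_cases h2 : (i : ℕ) + 1 = j
    · simp [h2.symm, hu j h2, show (i : ℕ) + 1 ≠ i - 1 by omega]
    by_cases h3 : (j : ℕ) + 1 = i
    · simp [h3.symm, hl j h3, show (j : ℕ) ≠ j + 1 + 1 by omega]
    · have : (j : ℕ) = i - 1 → (i : ℕ) = 0 := by omega
      simp +contextual [h1', Ne.symm h2, this, hzero j h1 h2 h3]
  rw [Finset.sum_congr rfl fun j _ => key j]
  simp only [Finset.sum_add_distrib, Fin.sum_ite_val_eq]
  have hi := i.isLt
  rw [if_pos hi, if_pos (show (i : ℕ) - 1 < n by omega)]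
  congr 1
  · congr 1
    split_ifs with h
    · rfl
    · exact (hu' (by omega)).symm
  · split_ifs with h
    · exact (hl' h).symm
    · rfl

lemma Matrix.isRoot_charpoly_of_mulVec_eq_smul {n R : Type*} [Fintype n] [DecidableEq n]
    [CommRing R] [IsDomain R] (M : Matrix n n R) (μ : R) (v : n → R) (hv : v ≠ 0)
    (h : M.mulVec v = μ • v) : M.charpoly.IsRoot μ := by
  rw [Polynomial.IsRoot, Matrix.eval_charpoly, ← Matrix.exists_mulVec_eq_zero_iff]
  refine ⟨v, hv, ?_⟩
  rw [Matrix.sub_mulVec, h, Matrix.scalar_apply, ← Matrix.smul_one_eq_diagonal, Matrix.smul_mulVec,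
    Matrix.one_mulVec, sub_self]

lemma Polynomial.Monic.eq_prod_X_sub_C_of_isRoot {R : Type*} [CommRing R] [IsDomain R]
    {p : Polynomial R} (hp : p.Monic) {ι : Type*} (s : Finset ι) (f : ι → R)
    (hf : Set.InjOn f s) (hroot : ∀ j ∈ s, p.IsRoot (f j)) (hdeg : p.natDegree ≤ s.card) :
    p = ∏ j ∈ s, (Polynomial.X - Polynomial.C (f j)) := by
  classical
  refine Polynomial.eq_of_monic_of_dvd_of_natDegree_le
    (Polynomial.monic_prod_of_monic _ _ fun j _ => Polynomial.monic_X_sub_C _) hp ?_ ?_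
  · rw [← Finset.prod_image (f := fun x => Polynomial.X - Polynomial.C x) hf]
    rw [Finset.prod, Multiset.prod_X_sub_C_dvd_iff_le_roots hp.ne_zero,
      Finset.val_le_iff_val_subset]
    intro x hx
    obtain ⟨j, hj, rfl⟩ := Finset.mem_image.mp hx
    exact (Polynomial.mem_roots hp.ne_zero).mpr (hroot j hj)
  · rwa [Polynomial.natDegree_prod_of_monic _ _ fun j _ => Polynomial.monic_X_sub_C _,
      Finset.sum_congr rfl fun j _ => Polynomial.natDegree_X_sub_C _, Finset.sum_const,
      smul_eq_mul, mul_one]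

/-- Let `B_k` be the `(k+1) × (k+1)` real symmetric tridiagonal matrix with diagonal entries
`2k + 2`, off-diagonal entries `(B_k)_{i, i+1} = (B_k)_{i+1, i} = 2 √((i+1)(k−i))` and all
other entries `0`.  Its characteristic polynomial is `∏_{j=0}^{k} (X − (4j + 2))`;
equivalently its eigenvalues are exactly `2 + 4j`, `0 ≤ j ≤ k`, each simple.  (These are the
eigenvalues of `x² + y²` of the Landau-level problem on the `k`-th diagonal of states.) -/
theorem stmt15 (k : ℕ) (B : Matrix (Fin (k + 1)) (Fin (k + 1)) ℝ)
    (hdiag : ∀ i, B i i = 2 * k + 2)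
    (hsup : ∀ i j : Fin (k + 1), (i : ℕ) + 1 = (j : ℕ) →
      B i j = 2 * Real.sqrt (((i : ℕ) + 1) * ((k - (i : ℕ) : ℕ) : ℝ)))
    (hsub : ∀ i j : Fin (k + 1), (j : ℕ) + 1 = (i : ℕ) →
      B i j = 2 * Real.sqrt (((j : ℕ) + 1) * ((k - (j : ℕ) : ℕ) : ℝ)))
    (hzero : ∀ i j : Fin (k + 1), i ≠ j → (i : ℕ) + 1 ≠ (j : ℕ) → (j : ℕ) + 1 ≠ (i : ℕ) →
      B i j = 0) :
    B.charpoly = ∏ j ∈ Finset.range (k + 1),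
      (Polynomial.X - Polynomial.C (4 * (j : ℝ) + 2)) := by
  refine (B.charpoly_monic).eq_prod_X_sub_C_of_isRoot (Finset.range (k + 1))
    (fun j : ℕ => 4 * (j : ℝ) + 2) (fun x _ y _ hxy => ?_) (fun a ha => ?_) (by simp)
  · simpa using hxy
  obtain ⟨b, rfl⟩ := Nat.exists_eq_add_of_le (Nat.lt_succ_iff.mp (Finset.mem_range.mp ha))
  set p : Polynomial ℝ := (1 + Polynomial.X) ^ a * (1 - Polynomial.X) ^ b with hp
  let w : ℕ → ℝ := fun i => √((i.factorial : ℝ) * ((a + b - i).factorial : ℝ))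
  refine B.isRoot_charpoly_of_mulVec_eq_smul _ (fun i => w i * p.coeff i) (fun h => ?_) ?_
  · have h0 := congrFun h 0
    have hw : w 0 ≠ 0 := by positivity
    simp [hw, hp, Polynomial.coeff_zero_eq_eval_zero] at h0
  ext i
  have hi := i.isLt
  have hrec := krawtchouk_coeff_rec a b i
  rw [← hp] at hrec
  rw [Matrix.mulVec, dotProduct, Fin.sum_eq_of_tridiagonal _ i
    (u := 2 * w i * ((i + 1) * p.coeff (i + 1)))
    (l := 2 * w i * ((a + b + 1 - i) * (Polynomial.X * p).coeff i))]
  · rw [hdiag, Pi.smul_apply, smul_eq_mul]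
    push_cast
    linear_combination 2 * w i * hrec
  · intro j h1 h2 h3
    rw [hzero i j h1 h2 h3, zero_mul]
  · intro j hj
    obtain ⟨m, hm⟩ := Nat.exists_eq_add_of_le (show (j : ℕ) ≤ a + b by omega)
    have h := sqrt_mul_sqrt_factorial_succ i m
    rw [hsup i j hj, ← hj]
    simp only [w, show a + b - (i : ℕ) = m + 1 by omega,
      show a + b - ((i : ℕ) + 1) = m by omega]
    linear_combination 2 * p.coeff (i + 1) * h
  · intro h
    rw [hp, krawtchouk_coeff_eq_zero a b _ (by omega)]
    ring
  · intro j hj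
    obtain ⟨m, hm⟩ := Nat.exists_eq_add_of_le (show (i : ℕ) ≤ a + b by omega)
    have h := sqrt_mul_sqrt_factorial j m
    have hm' : (a : ℝ) + b = j + 1 + m := by
      rw [← hj] at hm
      exact_mod_cast hm
    rw [hsub i j hj, ← hj, Polynomial.coeff_X_mul]
    simp only [w, show a + b - (j : ℕ) = m + 1 by omega,
      show a + b - ((j : ℕ) + 1) = m by omega]
    push_cast at h ⊢
    rw [hm']
    linear_combination 2 * p.coeff j * h
  · intro h
    rw [h, Polynomial.coeff_X_mul_zero]
    ring
end
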